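/- Let c₀ > 0 and let M ∈ C_c^∞(ℝ²) satisfy the flag-F₁ seminorm bounds with constants 𝒞. Set K(x,y) = M(x, y − c₀x²). Then the Fourier transform 𝓕K(ξ,η) = ∫∫ e^{−2πi(xξ+yη)} K(x,y) dx dy is bounded uniformly: there is a constant C depending only on c₀ and 𝒞 (and not on the support of M) such that |𝓕K(ξ,η)| ≤ C for all (ξ,η) ∈ ℝ². -/

import Mathlib

open Real Filter Topology MeasureTheory ENNReal NNReal

noncomputable section

/-- `eI r = exp(i r)`. -/
def eI (r : ℝ) : ℂ := Complex.exp (Complex.I * r)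

/-- A normalized bump function on `ℝ`: a `C^∞` function supported in `[-1,1]`
with `|φ| ≤ 1` and `|φ'| ≤ 1`. -/
def IsNormalizedBump (φ : ℝ → ℝ) : Prop :=
  ContDiff ℝ (⊤ : ℕ∞) φ ∧ (∀ t : ℝ, 1 < |t| → φ t = 0) ∧
  (∀ t, |φ t| ≤ 1) ∧ (∀ t, |deriv φ t| ≤ 1)

/-- A compactly supported smooth function `M` on `ℝ²` satisfies the flag-`F₁` seminorm
bounds with constants `𝒞 = (Cab, C1, C2)` if:
(i) `|∂_x^α ∂_y^β M(x,y)| ≤ Cab α β (|x|+|y|^{1/2})^{-1-α} |y|^{-1-β}` for `y ≠ 0`;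
(ii) for every normalized bump `φ` and `R > 0`, the functions
`y ↦ ∫ M(x,y) φ(Rx) dx` and `x ↦ ∫ M(x,y) φ(Ry) dy` are CZ kernels on `ℝ`
with constants `(C1, C2)` (decay and cancellation), uniformly in `φ` and `R`. -/
def FlagF1FunBounds (Cab : ℕ → ℕ → ℝ) (C1 : ℕ → ℝ) (C2 : ℝ) (M : ℝ → ℝ → ℂ) : Prop :=
  ContDiff ℝ (⊤ : ℕ∞) (fun p : ℝ × ℝ => M p.1 p.2) ∧
  HasCompactSupport (fun p : ℝ × ℝ => M p.1 p.2) ∧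
  (∀ (α β : ℕ) (x y : ℝ), y ≠ 0 →
    ‖iteratedDeriv α (fun x' : ℝ => iteratedDeriv β (fun y' : ℝ => M x' y') y) x‖
      ≤ Cab α β * (|x| + |y| ^ ((1:ℝ)/2)) ^ (-1 - (α : ℝ)) * |y| ^ (-1 - (β : ℝ))) ∧
  (∀ φ : ℝ → ℝ, IsNormalizedBump φ → ∀ R : ℝ, 0 < R →
    (∀ (α : ℕ) (y : ℝ), y ≠ 0 →
      ‖iteratedDeriv α (fun y' : ℝ => ∫ x : ℝ, M x y' * (φ (R * x) : ℂ)) y‖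
        ≤ C1 α * |y| ^ (-1 - (α : ℝ))) ∧
    (∀ δ : ℝ, 0 < δ → ∀ ψ : ℝ → ℝ, IsNormalizedBump ψ →
      ‖∫ y : ℝ, (∫ x : ℝ, M x y * (φ (R * x) : ℂ)) * (ψ (δ * y) : ℂ)‖ ≤ C2) ∧
    (∀ (α : ℕ) (x : ℝ), x ≠ 0 →
      ‖iteratedDeriv α (fun x' : ℝ => ∫ y : ℝ, M x' y * (φ (R * y) : ℂ)) x‖
        ≤ C1 α * |x| ^ (-1 - (α : ℝ))) ∧
    (∀ δ : ℝ, 0 < δ → ∀ ψ : ℝ → ℝ, IsNormalizedBump ψ →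
      ‖∫ x : ℝ, (∫ y : ℝ, M x y * (φ (R * y) : ℂ)) * (ψ (δ * x) : ℂ)‖ ≤ C2))

lemma eI_add (r s : ℝ) : eI (r + s) = eI r * eI s := by
  simp [eI, ← Complex.exp_add, mul_add]

lemma norm_eI (r : ℝ) : ‖eI r‖ = 1 := by
  rw [eI, mul_comm, Complex.norm_exp_ofReal_mul_I]

lemma contDiff_eI {n : WithTop ℕ∞} : ContDiff ℝ n eI := by
  unfold eI
  exact (contDiff_const.mul Complex.ofRealCLM.contDiff).cexp

lemma continuous_eI : Continuous eI := (contDiff_eI (n := 0)).continuous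

lemma HasDerivAt.eI {f : ℝ → ℝ} {f' x : ℝ} (hf : HasDerivAt f f' x) :
    HasDerivAt (fun x => eI (f x)) (Complex.I * f' * eI (f x)) x := by
  have h := (hf.ofReal_comp.const_mul Complex.I).cexp
  simp only [_root_.eI]
  convert h using 1
  ring

/-- The oscillating factor with phase `-(a x + κ x²)`. -/
def quadOsc (a κ x : ℝ) : ℂ := eI (-(a * x + κ * x ^ 2))

lemma norm_quadOsc (a κ x : ℝ) : ‖quadOsc a κ x‖ = 1 := norm_eI _

lemma contDiff_quadOsc (a κ : ℝ) {n : WithTop ℕ∞} : ContDiff ℝ n (quadOsc a κ) :=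
  contDiff_eI.comp (by fun_prop)

lemma hasDerivAt_quadOsc (a κ x : ℝ) :
    HasDerivAt (quadOsc a κ) (Complex.I * (-(a + 2 * κ * x) : ℝ) * quadOsc a κ x) x := by
  have h : HasDerivAt (fun x : ℝ => -(a * x + κ * x ^ 2)) (-(a + 2 * κ * x)) x := by
    have := ((hasDerivAt_id' x).const_mul a).add ((hasDerivAt_pow 2 x).const_mul κ)
    refine this.neg.congr_deriv ?_
    push_cast
    ring
  exact h.eI

/-- Integration by parts against a quadratic phase `P`, with the regularized inverse
`P' / (|κ| + P'²)` of `P'` so that no case distinction at the critical point is needed. -/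
lemma norm_integral_quadOsc_mul_le {a κ : ℝ} (hκ : κ ≠ 0) {g g' : ℝ → ℂ} {h : ℝ → ℝ}
    (hg : ∀ x, HasDerivAt g (g' x) x) (hg' : Continuous g') (hs : HasCompactSupport g)
    (hh : Integrable h)
    (hle : ∀ x, 3 * (|κ| / (|κ| + (a + 2 * κ * x) ^ 2)) * ‖g x‖
      + |a + 2 * κ * x| / (|κ| + (a + 2 * κ * x) ^ 2) * ‖g' x‖ ≤ h x) :
    ‖∫ x, quadOsc a κ x * g x‖ ≤ ∫ x, h x := by
  have hρ : 0 < |κ| := abs_pos.2 hκ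
  set ρ := |κ| with hρdef
  set p : ℝ → ℝ := fun x => a + 2 * κ * x with hp
  have hD : ∀ x, 0 < ρ + p x ^ 2 := fun x => by positivity
  set q : ℝ → ℝ := fun x => p x / (ρ + p x ^ 2) with hq
  set q' : ℝ → ℝ := fun x => 2 * κ * (ρ - p x ^ 2) / (ρ + p x ^ 2) ^ 2 with hq'
  have hpc : Continuous p := by fun_prop
  have hqc : Continuous q := hpc.div (by fun_prop) (fun x => (hD x).ne')
  have hqc' : Continuous q' := by
    apply Continuous.div (by fun_prop) (by fun_prop)
    intro x
    have := hD x
    positivity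
  have hpd : ∀ x, HasDerivAt p (2 * κ) x := fun x =>
    (((hasDerivAt_id' x).const_mul (2 * κ)).const_add a).congr_deriv (mul_one _)
  have hqd : ∀ x, HasDerivAt q (q' x) x := fun x => by
    have := (hpd x).div (((hpd x).pow 2).const_add ρ) (hD x).ne'
    refine this.congr_deriv ?_
    simp only [hq']
    congr 1
    simp only [Pi.pow_apply, Nat.cast_ofNat]
    ring
  have hgc : Continuous g := continuous_iff_continuousAt.2 fun x => (hg x).continuousAt
  have hEc : Continuous (quadOsc a κ) := (contDiff_quadOsc a κ (n := 0)).continuous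
  have hderiv : deriv g = g' := funext fun x => (hg x).deriv
  have hs' : HasCompactSupport g' := hderiv ▸ hs.deriv
  set F : ℝ → ℂ := fun x => quadOsc a κ x * q x * g x with hF
  set F' : ℝ → ℂ := fun x =>
    (Complex.I * (-(p x) : ℝ) * quadOsc a κ x * q x + quadOsc a κ x * q' x) * g x
      + quadOsc a κ x * q x * g' x with hF'
  have hFd : ∀ x, HasDerivAt F (F' x) x := fun x =>
    ((hasDerivAt_quadOsc a κ x).mul (hqd x).ofReal_comp).mul (hg x)
  have hFint : Integrable F :=
    Continuous.integrable_of_hasCompactSupport (by fun_prop) hs.mul_left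
  have hFint' : Integrable F' :=
    Continuous.integrable_of_hasCompactSupport (by fun_prop) (hs.mul_left.add hs'.mul_left)
  have hF0 : ∫ x, F' x = 0 := integral_eq_zero_of_hasDerivAt_of_integrable hFd hFint' hFint
  have hEg : Integrable fun x => quadOsc a κ x * g x :=
    Continuous.integrable_of_hasCompactSupport (by fun_prop) hs.mul_left
  have key : ∫ x, quadOsc a κ x * g x
      = ∫ x, (quadOsc a κ x * g x - Complex.I * F' x) := by
    rw [integral_sub hEg (hFint'.const_mul _), integral_const_mul, hF0]
    simp
  rw [key]
  refine norm_integral_le_of_norm_le hh (Eventually.of_forall fun x => (le_trans ?_ (hle x)))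
  have hpq : p x * q x = 1 - ρ / (ρ + p x ^ 2) := by
    have := (hD x).ne'
    simp only [hq]
    field_simp
    ring
  have e : quadOsc a κ x * g x - Complex.I * F' x
      = quadOsc a κ x * (((ρ / (ρ + p x ^ 2) : ℝ) : ℂ) * g x - Complex.I * (q' x : ℂ) * g x
        - Complex.I * (q x : ℂ) * g' x) := by
    have hpq' : (p x : ℂ) * (q x : ℂ) = 1 - ((ρ / (ρ + p x ^ 2) : ℝ) : ℂ) := by
      exact_mod_cast hpq
    simp only [hF']
    push_cast at hpq' ⊢
    linear_combination (quadOsc a κ x * g x) * (p x * q x : ℂ) * (Complex.I_sq)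
      - (quadOsc a κ x * g x) * hpq'
  rw [e, norm_mul, norm_quadOsc, one_mul]
  have hq'le : |q' x| ≤ 2 * (ρ / (ρ + p x ^ 2)) := by
    simp only [hq']
    rw [abs_div, abs_mul, abs_mul, abs_of_pos (pow_pos (hD x) 2), ← hρdef,
      div_le_iff₀ (pow_pos (hD x) 2)]
    have h1 : |ρ - p x ^ 2| ≤ ρ + p x ^ 2 := abs_le.2 ⟨by nlinarith [sq_nonneg (p x)], by
      nlinarith [sq_nonneg (p x)]⟩
    have h2 : 2 * (ρ / (ρ + p x ^ 2)) * (ρ + p x ^ 2) ^ 2 = 2 * ρ * (ρ + p x ^ 2) := by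
      have := (hD x).ne'
      field_simp
    rw [h2, abs_of_pos (by norm_num : (0:ℝ) < 2)]
    gcongr
  have hqabs : |q x| = |p x| / (ρ + p x ^ 2) := by
    simp only [hq]
    rw [abs_div, abs_of_pos (hD x)]
  calc _ ≤ ‖((ρ / (ρ + p x ^ 2) : ℝ) : ℂ) * g x‖ + ‖Complex.I * (q' x : ℂ) * g x‖
        + ‖Complex.I * (q x : ℂ) * g' x‖ :=
        (norm_sub_le _ _).trans (add_le_add_left (norm_sub_le _ _) _)
    _ = ρ / (ρ + p x ^ 2) * ‖g x‖ + |q' x| * ‖g x‖ + |p x| / (ρ + p x ^ 2) * ‖g' x‖ := by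
        rw [← hqabs]
        simp only [norm_mul, Complex.norm_I, one_mul, Complex.norm_real, Real.norm_eq_abs]
        rw [abs_of_pos (div_pos hρ (hD x))]
    _ ≤ ρ / (ρ + p x ^ 2) * ‖g x‖ + 2 * (ρ / (ρ + p x ^ 2)) * ‖g x‖
        + |p x| / (ρ + p x ^ 2) * ‖g' x‖ := by gcongr
    _ = _ := by ring

lemma integrable_inv_one_add_affine_sq {m : ℝ} (hm : m ≠ 0) (k : ℝ) :
    Integrable fun x : ℝ => (1 + (m * x + k) ^ 2)⁻¹ :=
  (integrable_inv_one_add_sq.comp_add_right k).comp_mul_left' hm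

lemma integral_inv_one_add_affine_sq (m k : ℝ) :
    ∫ x : ℝ, (1 + (m * x + k) ^ 2)⁻¹ = |m⁻¹| * π := by
  rw [Measure.integral_comp_mul_left (fun x : ℝ => (1 + (x + k) ^ 2)⁻¹) m,
    integral_add_right_eq_self (fun x : ℝ => (1 + x ^ 2)⁻¹), integral_univ_inv_one_add_sq,
    smul_eq_mul]

lemma integrable_div_one_add_mul_sq {σ : ℝ} (hσ : 0 < σ) :
    Integrable fun x : ℝ => σ / (1 + (σ * x) ^ 2) := by
  simpa [div_eq_mul_inv] using (integrable_inv_one_add_affine_sq hσ.ne' 0).const_mul σ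

lemma integral_div_one_add_mul_sq {σ : ℝ} (hσ : 0 < σ) :
    ∫ x : ℝ, σ / (1 + (σ * x) ^ 2) = π := by
  have h := integral_inv_one_add_affine_sq σ 0
  simp only [add_zero] at h
  simp only [div_eq_mul_inv, integral_const_mul, h, abs_inv, abs_of_pos hσ]
  field_simp

private lemma quad_weight_eq {a κ : ℝ} (hκ : κ ≠ 0) (x : ℝ) :
    |κ| / (|κ| + (a + 2 * κ * x) ^ 2)
      = (1 + (2 * κ / √|κ| * x + a / √|κ|) ^ 2)⁻¹ := by
  have hρ : 0 < |κ| := abs_pos.2 hκ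
  have hs : 0 < √|κ| := Real.sqrt_pos.2 hρ
  have h : 2 * κ / √|κ| * x + a / √|κ| = (a + 2 * κ * x) / √|κ| := by field_simp; ring
  rw [h, div_pow, Real.sq_sqrt hρ.le]
  field_simp

lemma integrable_quad_weight {a κ : ℝ} (hκ : κ ≠ 0) :
    Integrable fun x : ℝ => |κ| / (|κ| + (a + 2 * κ * x) ^ 2) := by
  simp only [quad_weight_eq hκ]
  have hs : √|κ| ≠ 0 := (Real.sqrt_pos.2 (abs_pos.2 hκ)).ne'
  exact integrable_inv_one_add_affine_sq (by positivity) _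

lemma integral_quad_weight {a κ : ℝ} (hκ : κ ≠ 0) :
    ∫ x : ℝ, |κ| / (|κ| + (a + 2 * κ * x) ^ 2) = π / (2 * √|κ|) := by
  simp only [quad_weight_eq hκ]
  have hρ : 0 < |κ| := abs_pos.2 hκ
  have hs : 0 < √|κ| := Real.sqrt_pos.2 hρ
  rw [integral_inv_one_add_affine_sq, abs_inv, abs_div, abs_mul, abs_of_pos hs,
    abs_of_pos (by norm_num : (0:ℝ) < 2)]
  have h : |κ| = √|κ| * √|κ| := (Real.mul_self_sqrt hρ.le).symm
  field_simp
  rw [sq, ← h]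

lemma abs_div_add_sq_le {ρ : ℝ} (hρ : 0 < ρ) (p : ℝ) : |p| / (ρ + p ^ 2) ≤ 1 / (2 * √ρ) := by
  have hs : 0 < √ρ := Real.sqrt_pos.2 hρ
  rw [div_le_div_iff₀ (by positivity) (by positivity)]
  nlinarith [sq_nonneg (|p| - √ρ), Real.sq_sqrt hρ.le, sq_abs p]

/-- Oscillatory integral of a bounded function whose derivative has the size of an
approximate identity. -/
lemma norm_integral_quadOsc_mul_le_of_bounded {a κ : ℝ} (hκ : κ ≠ 0) {g g' : ℝ → ℂ}
    (hg : ∀ x, HasDerivAt g (g' x) x) (hg' : Continuous g') (hs : HasCompactSupport g)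
    {A τ : ℝ} (hτ : 0 < τ) (hb : ∀ x, ‖g x‖ ≤ A)
    (hb' : ∀ x, ‖g' x‖ ≤ A * (τ / (1 + (τ * x) ^ 2))) :
    ‖∫ x, quadOsc a κ x * g x‖ ≤ 2 * π * A / √|κ| := by
  have hρ : 0 < |κ| := abs_pos.2 hκ
  have hsq : 0 < √|κ| := Real.sqrt_pos.2 hρ
  have i1 := (integrable_quad_weight (a := a) hκ).const_mul (3 * A)
  have i2 := (integrable_div_one_add_mul_sq hτ).const_mul (1 / (2 * √|κ|) * A)
  refine (norm_integral_quadOsc_mul_le hκ hg hg' hs (i1.add i2) fun x => ?_).trans ?_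
  · have hD : 0 < |κ| + (a + 2 * κ * x) ^ 2 := by positivity
    simp only [Pi.add_apply]
    have h1 := abs_div_add_sq_le hρ (a + 2 * κ * x)
    have h2 : 3 * (|κ| / (|κ| + (a + 2 * κ * x) ^ 2)) * ‖g x‖
        ≤ 3 * (|κ| / (|κ| + (a + 2 * κ * x) ^ 2)) * A :=
      mul_le_mul_of_nonneg_left (hb x) (by positivity)
    have h3 := mul_le_mul h1 (hb' x) (norm_nonneg _) (by positivity)
    linarith
  · simp only [Pi.add_apply]
    rw [integral_add i1 i2, integral_const_mul, integral_const_mul, integral_quad_weight hκ,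
      integral_div_one_add_mul_sq hτ]
    apply le_of_eq
    field_simp
    ring

private lemma quad_weight_near_le {s b p X D A : ℝ} (hs : 0 < s) (hb : 0 ≤ b) (hX : 0 < X)
    (hA : 0 ≤ A) (hD : D = s ^ 2 + p ^ 2) (hsX : s * X ≤ 1) (hbp : b ≤ |p| + 2 * s ^ 2 * X)
    (hσX : 1 / 2 ≤ (b + s) * X) :
    3 * (s ^ 2 / D) * (A / X) + |p| / D * (A / X ^ 2)
      ≤ 295 * A * ((b + s) / (1 + ((b + s) * X) ^ 2)) := by
  have hD0 : 0 < D := by rw [hD]; positivity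
  obtain ⟨σ, hσdef⟩ : ∃ σ, σ = b + s := ⟨_, rfl⟩
  rw [← hσdef] at hσX ⊢
  have hσ : 0 < σ := by linarith
  have hsσ : s ≤ σ := by linarith
  have hp : σ ≤ |p| + 3 * s := by nlinarith
  have hpsq : |p| ^ 2 ≤ D := by rw [hD, sq_abs]; nlinarith
  have hDσ : σ ^ 2 ≤ 18 * D := by
    calc σ ^ 2 ≤ (|p| + 3 * s) ^ 2 := by gcongr
      _ ≤ 18 * D := by
        rw [hD, ← sq_abs p]
        nlinarith [sq_nonneg (|p| - 3 * s), sq_nonneg |p|]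
  have hpD : |p| * σ ≤ 5 * D := by
    refine (abs_le_of_sq_le_sq' ?_ (by positivity)).2
    calc (|p| * σ) ^ 2 = |p| ^ 2 * σ ^ 2 := by ring
      _ ≤ D * (18 * D) := by gcongr
      _ ≤ (5 * D) ^ 2 := by nlinarith [sq_nonneg D]
  have c1 : s ^ 2 / D ≤ 18 * s ^ 2 / σ ^ 2 := by
    rw [div_le_div_iff₀ hD0 (by positivity)]
    nlinarith [mul_le_mul_of_nonneg_left hDσ (sq_nonneg s)]
  have c2 : |p| / D ≤ 5 / σ := by
    rw [div_le_div_iff₀ hD0 hσ]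
    exact hpD
  have c3 : 3 * (s ^ 2 / D) * (A / X) ≤ 54 * (A / (σ * X ^ 2)) := by
    calc 3 * (s ^ 2 / D) * (A / X) ≤ 3 * (18 * s ^ 2 / σ ^ 2) * (A / X) := by gcongr
      _ = 54 * (A / (σ * X ^ 2)) * ((s / σ) * (s * X)) := by field_simp; ring
      _ ≤ 54 * (A / (σ * X ^ 2)) * (1 * 1) := by
          gcongr
          exact (div_le_one hσ).2 hsσ
      _ = _ := by ring
  have c4 : |p| / D * (A / X ^ 2) ≤ 5 * (A / (σ * X ^ 2)) := by
    calc _ ≤ 5 / σ * (A / X ^ 2) := by gcongr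
      _ = _ := by field_simp
  have c5 : A / (σ * X ^ 2) ≤ 5 * A * (σ / (1 + (σ * X) ^ 2)) := by
    rw [← mul_div_assoc, div_le_div_iff₀ (by positivity) (by positivity)]
    have : 1 ≤ 4 * (σ * X) ^ 2 := by nlinarith
    nlinarith [mul_nonneg hA (sub_nonneg.2 this)]
  linarith

private lemma quad_weight_far_le {s p X D A : ℝ} (hs : 0 < s) (hX : 0 < X)
    (hA : 0 ≤ A) (hD : D = s ^ 2 + p ^ 2) (hsX : 1 ≤ s * X) :
    3 * (s ^ 2 / D) * (A / X) + |p| / D * (A / X ^ 2)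
      ≤ A * (s / (1 + (s * X) ^ 2)) + 3 * s * A * (s ^ 2 / D) := by
  have hD0 : 0 < D := by rw [hD]; positivity
  have c1 : 3 * (s ^ 2 / D) * (A / X) ≤ 3 * s * A * (s ^ 2 / D) := by
    have : A / X ≤ s * A := by
      rw [div_le_iff₀ hX]
      nlinarith
    calc _ ≤ 3 * (s ^ 2 / D) * (s * A) := by gcongr
      _ = _ := by ring
  have c2 : |p| / D * (A / X ^ 2) ≤ A * (s / (1 + (s * X) ^ 2)) := by
    have h := abs_div_add_sq_le (pow_pos hs 2) p
    rw [Real.sqrt_sq hs.le, ← hD] at h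
    calc _ ≤ 1 / (2 * s) * (A / X ^ 2) := by gcongr
      _ = A / (2 * s * X ^ 2) := by field_simp
      _ ≤ A * (s / (1 + (s * X) ^ 2)) := by
          rw [← mul_div_assoc, div_le_div_iff₀ (by positivity) (by positivity)]
          have : 1 ≤ (s * X) ^ 2 := by nlinarith
          nlinarith [mul_nonneg hA (sub_nonneg.2 this)]
  linarith

/-- Oscillatory integral of a Calderón–Zygmund kernel truncated away from the scale
on which the phase is essentially constant. -/
lemma norm_integral_quadOsc_mul_le_of_truncated {a κ : ℝ} (hκ : κ ≠ 0) {g g' : ℝ → ℂ}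
    (hg : ∀ x, HasDerivAt g (g' x) x) (hg' : Continuous g') (hs : HasCompactSupport g)
    {A : ℝ} (hA : 0 ≤ A) (hz : ∀ x, (|a| + √|κ|) * |x| < 1 / 2 → g x = 0 ∧ g' x = 0)
    (hb : ∀ x, x ≠ 0 → ‖g x‖ ≤ A / |x|) (hb' : ∀ x, x ≠ 0 → ‖g' x‖ ≤ A / x ^ 2) :
    ‖∫ x, quadOsc a κ x * g x‖ ≤ 300 * π * A := by
  have hρ : 0 < |κ| := abs_pos.2 hκ
  have hsq : 0 < √|κ| := Real.sqrt_pos.2 hρ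
  set s := √|κ| with hsdef
  have hss : |κ| = s ^ 2 := (Real.sq_sqrt hρ.le).symm
  set σ := |a| + s with hσdef
  have hσ : 0 < σ := by positivity
  have hsσ : s ≤ σ := by simp [hσdef]
  have i1 := (integrable_div_one_add_mul_sq hσ).const_mul (295 * A)
  have i2 := (integrable_div_one_add_mul_sq hsq).const_mul A
  have i3 := (integrable_quad_weight (a := a) hκ).const_mul (3 * s * A)
  refine (norm_integral_quadOsc_mul_le hκ hg hg' hs ((i1.add i2).add i3) fun x => ?_).trans ?_
  · simp only [Pi.add_apply]
    have hD : 0 < |κ| + (a + 2 * κ * x) ^ 2 := by positivity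
    have n1 : 0 ≤ 295 * A * (σ / (1 + (σ * x) ^ 2)) := by positivity
    have n2 : 0 ≤ A * (s / (1 + (s * x) ^ 2)) := by positivity
    have n3 : 0 ≤ 3 * s * A * (|κ| / (|κ| + (a + 2 * κ * x) ^ 2)) := by positivity
    rcases lt_or_ge (σ * |x|) (1 / 2) with hx | hx
    · rw [(hz x hx).1, (hz x hx).2]
      simp only [norm_zero, mul_zero, add_zero]
      linarith
    have hx0 : 0 < |x| := by
      rcases (abs_nonneg x).eq_or_lt with h | h
      · rw [← h] at hx; norm_num at hx
      · exact h
    have hxne : x ≠ 0 := abs_pos.1 hx0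
    set D := |κ| + (a + 2 * κ * x) ^ 2 with hDdef
    have hgx := hb x hxne
    have hgx' := hb' x hxne
    rw [← sq_abs x] at hgx'
    have t1 : 3 * (|κ| / D) * ‖g x‖ ≤ 3 * (|κ| / D) * (A / |x|) := by gcongr
    have t2 : |a + 2 * κ * x| / D * ‖g' x‖ ≤ |a + 2 * κ * x| / D * (A / |x| ^ 2) := by gcongr
    have ex : ∀ m : ℝ, (m * x) ^ 2 = (m * |x|) ^ 2 := fun m => by
      rw [mul_pow, mul_pow, sq_abs]
    have hDs : D = s ^ 2 + (a + 2 * κ * x) ^ 2 := by rw [hDdef, hss]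
    rw [ex] at n1 n2 ⊢
    rw [ex]
    rw [hss] at t1 n3 ⊢
    rcases le_total (s * |x|) 1 with h | h
    · have hp : |a| ≤ |a + 2 * κ * x| + 2 * s ^ 2 * |x| := by
        calc |a| = |(a + 2 * κ * x) - 2 * κ * x| := by congr 1; ring
          _ ≤ |a + 2 * κ * x| + |2 * κ * x| := abs_sub _ _
          _ = _ := by rw [abs_mul, abs_mul, abs_two, hss]
      have := quad_weight_near_le hsq (abs_nonneg a) hx0 hA hDs h hp hx
      linarith
    · have := quad_weight_far_le hsq hx0 hA hDs h
      linarith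
  · simp only [Pi.add_apply]
    have e := integral_add (i1.add i2) i3
    simp only [Pi.add_apply] at e
    rw [e, integral_add i1 i2, integral_const_mul, integral_const_mul, integral_const_mul,
      integral_quad_weight hκ, integral_div_one_add_mul_sq hσ, integral_div_one_add_mul_sq hsq]
    rw [← hsdef]
    have : 3 * s * A * (π / (2 * s)) = 3 / 2 * (A * π) := by field_simp
    rw [this]
    nlinarith [mul_nonneg hA Real.pi_pos.le]

section ParametricIntegral

variable {N N' : ℝ → ℝ → ℂ} {θ : ℝ → ℂ}

lemma HasCompactSupport.exists_forall_lt_abs_eq_zero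
    (hs : HasCompactSupport fun p : ℝ × ℝ => N p.1 p.2) :
    ∃ B : ℝ, ∀ x y, B < |x| ∨ B < |y| → N x y = 0 := by
  obtain ⟨B, hB⟩ := hs.isBounded.subset_closedBall 0
  refine ⟨B, fun x y h => ?_⟩
  by_contra hne
  have hmem := hB (subset_tsupport _ (show (x, y) ∈ Function.support _ from hne))
  rw [mem_closedBall_zero_iff, Prod.norm_def, max_le_iff] at hmem
  simp only [Real.norm_eq_abs] at hmem
  rcases h with h | h
  · linarith [hmem.1]
  · linarith [hmem.2]

lemma hasCompactSupport_of_forall_lt_abs {f : ℝ → ℂ} {B : ℝ} (h : ∀ x, B < |x| → f x = 0) :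
    HasCompactSupport f :=
  HasCompactSupport.intro (isCompact_closedBall 0 B) fun x hx => h x (by simpa using hx)

lemma hasCompactSupport_integral_right (hs : HasCompactSupport fun p : ℝ × ℝ => N p.1 p.2) :
    HasCompactSupport fun x => ∫ y, N x y * θ y := by
  obtain ⟨B, hB⟩ := hs.exists_forall_lt_abs_eq_zero
  exact hasCompactSupport_of_forall_lt_abs (B := B) fun x hx => by simp [hB x _ (Or.inl hx)]

lemma continuous_integral_right (hN : Continuous fun p : ℝ × ℝ => N p.1 p.2)
    (hs : HasCompactSupport fun p : ℝ × ℝ => N p.1 p.2) (hθ : Continuous θ) :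
    Continuous fun x => ∫ y, N x y * θ y := by
  obtain ⟨B, hB⟩ := hs.exists_forall_lt_abs_eq_zero
  rw [← continuousOn_univ]
  refine continuousOn_integral_of_compact_support (k := Metric.closedBall 0 B)
    (isCompact_closedBall 0 B) ?_ fun x y _ hy => ?_
  · exact (hN.mul (hθ.comp continuous_snd)).continuousOn
  · rw [hB x y (Or.inr (by simpa using hy)), zero_mul]

lemma integrable_section_mul (hN : Continuous fun p : ℝ × ℝ => N p.1 p.2)
    (hs : HasCompactSupport fun p : ℝ × ℝ => N p.1 p.2) (hθ : Continuous θ) (x : ℝ) :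
    Integrable fun y => N x y * θ y := by
  obtain ⟨B, hB⟩ := hs.exists_forall_lt_abs_eq_zero
  have hc : Continuous fun y => N x y := hN.comp (Continuous.prodMk_right x)
  exact (hc.mul hθ).integrable_of_hasCompactSupport
    (hasCompactSupport_of_forall_lt_abs (B := B) fun y hy => by simp [hB x y (Or.inr hy)])

lemma hasDerivAt_integral_right (hN : Continuous fun p : ℝ × ℝ => N p.1 p.2)
    (hs : HasCompactSupport fun p : ℝ × ℝ => N p.1 p.2)
    (hN' : Continuous fun p : ℝ × ℝ => N' p.1 p.2)
    (hs' : HasCompactSupport fun p : ℝ × ℝ => N' p.1 p.2)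
    (hd : ∀ x y, HasDerivAt (fun x => N x y) (N' x y) x) (hθ : Continuous θ) (x : ℝ) :
    HasDerivAt (fun x => ∫ y, N x y * θ y) (∫ y, N' x y * θ y) x := by
  obtain ⟨B, hB⟩ := hs'.exists_forall_lt_abs_eq_zero
  have hc : Continuous fun p : ℝ × ℝ => N' p.1 p.2 * θ p.2 := hN'.mul (hθ.comp continuous_snd)
  obtain ⟨C, hC⟩ := hc.bounded_above_of_compact_support hs'.mul_right
  refine (hasDerivAt_integral_of_dominated_loc_of_deriv_le
    (bound := (Metric.closedBall (0 : ℝ) B).indicator fun _ => C)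
    (F' := fun x y => N' x y * θ y) univ_mem ?_ (integrable_section_mul hN hs hθ x)
    (integrable_section_mul hN' hs' hθ x).aestronglyMeasurable ?_ ?_ ?_).2
  · exact Eventually.of_forall fun x => (integrable_section_mul hN hs hθ x).aestronglyMeasurable
  · refine Eventually.of_forall fun y x _ => ?_
    by_cases hy : y ∈ Metric.closedBall (0 : ℝ) B
    · rw [Set.indicator_of_mem hy]
      exact hC (x, y)
    · rw [Set.indicator_of_notMem hy, hB x y (Or.inr (by simpa using hy))]
      simp
  · exact (integrable_indicator_iff Metric.isClosed_closedBall.measurableSet).2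
      (integrableOn_const (isCompact_closedBall _ _).measure_ne_top)
  · exact Eventually.of_forall fun y x _ => (hd x y).mul_const _

lemma ContDiff.exists_hasDerivAt_fst (hN : ContDiff ℝ (⊤ : ℕ∞) fun p : ℝ × ℝ => N p.1 p.2)
    (hs : HasCompactSupport fun p : ℝ × ℝ => N p.1 p.2) :
    ∃ N' : ℝ → ℝ → ℂ, (Continuous fun p : ℝ × ℝ => N' p.1 p.2) ∧
      (HasCompactSupport fun p : ℝ × ℝ => N' p.1 p.2) ∧
      ∀ x y, HasDerivAt (fun x => N x y) (N' x y) x := by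
  have hne : ((⊤ : ℕ∞) : WithTop ℕ∞) ≠ 0 := by simp
  refine ⟨fun x y => fderiv ℝ (fun p : ℝ × ℝ => N p.1 p.2) (x, y) (1, 0), ?_, ?_, fun x y => ?_⟩
  · exact (hN.continuous_fderiv hne).clm_apply continuous_const
  · exact hs.fderiv_apply ℝ (1, 0)
  · have h1 := (hN.differentiable hne (x, y)).hasFDerivAt
    have h2 : HasDerivAt (fun x : ℝ => (x, y)) ((1 : ℝ), (0 : ℝ)) x :=
      (hasDerivAt_id x).prodMk (hasDerivAt_const x y)
    exact h1.comp_hasDerivAt x h2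

end ParametricIntegral

section Bump

/-- A complex-valued smooth function supported in `[-1,1]` which, with its derivative,
is bounded by `L`. -/
structure IsComplexBump (L : ℝ) (Θ : ℝ → ℂ) : Prop where
  contDiff : ContDiff ℝ (⊤ : ℕ∞) Θ
  eq_zero : ∀ t : ℝ, 1 < |t| → Θ t = 0
  norm_le : ∀ t, ‖Θ t‖ ≤ L
  norm_deriv_le : ∀ t, ‖deriv Θ t‖ ≤ L

variable {L : ℝ} {Θ : ℝ → ℂ}

lemma IsComplexBump.isNormalizedBump (h : IsComplexBump L Θ) (hL : 0 < L) (l : ℂ →L[ℝ] ℝ)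
    (hl : ∀ z, |l z| ≤ ‖z‖) : IsNormalizedBump fun t => L⁻¹ * l (Θ t) := by
  have hd : Differentiable ℝ Θ := h.contDiff.differentiable (by simp)
  have key : ∀ z : ℂ, ‖z‖ ≤ L → |L⁻¹ * l z| ≤ 1 := fun z hz => by
    rw [abs_mul, abs_inv, abs_of_pos hL, inv_mul_le_iff₀ hL, mul_one]
    exact (hl z).trans hz
  refine ⟨contDiff_const.mul (l.contDiff.comp h.contDiff), fun t ht => ?_,
    fun t => key _ (h.norm_le t), fun t => ?_⟩
  · simp [h.eq_zero t ht]
  · have : HasDerivAt (fun t => L⁻¹ * l (Θ t)) (L⁻¹ * l (deriv Θ t)) t :=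
      ((l.hasFDerivAt (x := Θ t)).comp_hasDerivAt t (hd t).hasDerivAt).const_mul _
    rw [this.deriv]
    exact key _ (h.norm_deriv_le t)

/-- A complex bump is a combination of two normalized bumps. -/
lemma IsComplexBump.exists_eq (h : IsComplexBump L Θ) (hL : 0 < L) :
    ∃ φ₁ φ₂ : ℝ → ℝ, IsNormalizedBump φ₁ ∧ IsNormalizedBump φ₂ ∧
      ∀ t, Θ t = L * ((φ₁ t : ℂ) + Complex.I * (φ₂ t : ℂ)) := by
  refine ⟨_, _, h.isNormalizedBump hL Complex.reCLM Complex.abs_re_le_norm,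
    h.isNormalizedBump hL Complex.imCLM Complex.abs_im_le_norm, fun t => ?_⟩
  have hL' : (L : ℂ) ≠ 0 := by exact_mod_cast hL.ne'
  simp only [Complex.reCLM_apply, Complex.imCLM_apply]
  push_cast
  rw [mul_add]
  rw [← mul_assoc, mul_inv_cancel₀ hL', one_mul]
  rw [mul_left_comm Complex.I, ← mul_assoc, mul_inv_cancel₀ hL', one_mul]
  exact (mul_comm Complex.I _ ▸ Complex.re_add_im (Θ t)).symm

lemma exists_smooth_cutoff : ∃ (χ : ℝ → ℝ) (B : ℝ), ContDiff ℝ (⊤ : ℕ∞) χ ∧ 0 ≤ B ∧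
    (∀ t, |t| ≤ 1 / 2 → χ t = 1) ∧ (∀ t, 1 ≤ |t| → χ t = 0) ∧ (∀ t, 0 ≤ χ t) ∧ (∀ t, χ t ≤ 1) ∧
    ∀ t, |deriv χ t| ≤ B := by
  let f : ContDiffBump (0 : ℝ) := ⟨1 / 2, 1, by norm_num, by norm_num⟩
  have hf : ContDiff ℝ (⊤ : ℕ∞) f := f.contDiff
  obtain ⟨B, hB⟩ := (hf.continuous_deriv (by simp)).bounded_above_of_compact_support
    (f.hasCompactSupport.deriv)
  refine ⟨f, B, hf, (norm_nonneg _).trans (hB 0), fun t ht => ?_, fun t ht => ?_, fun t => f.nonneg,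
    fun t => f.le_one, hB⟩
  · exact f.one_of_mem_closedBall (by simpa [f] using ht)
  · exact f.zero_of_le_dist (by simpa using ht)

lemma deriv_eq_zero_of_isMinOn {χ : ℝ → ℝ} {t : ℝ} (h : ∀ s, χ t ≤ χ s) : deriv χ t = 0 :=
  IsLocalMin.deriv_eq_zero (Eventually.of_forall h)

lemma deriv_eq_zero_of_isMaxOn {χ : ℝ → ℝ} {t : ℝ} (h : ∀ s, χ s ≤ χ t) : deriv χ t = 0 :=
  IsLocalMax.deriv_eq_zero (Eventually.of_forall h)

lemma isComplexBump_quadOsc_mul {χ : ℝ → ℝ} {B K a κ : ℝ} (hχ : ContDiff ℝ (⊤ : ℕ∞) χ)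
    (h1 : ∀ t, 1 ≤ |t| → χ t = 0) (h0 : ∀ t, 0 ≤ χ t) (hle : ∀ t, χ t ≤ 1) (hB : 0 ≤ B)
    (hd : ∀ t, |deriv χ t| ≤ B) (hK : |a| + 2 * |κ| ≤ K) :
    IsComplexBump (1 + B + K) fun t => quadOsc a κ t * χ t := by
  have hK0 : 0 ≤ K := by linarith [abs_nonneg a, abs_nonneg κ]
  have hn : ∀ t, ‖(χ t : ℂ)‖ ≤ 1 := fun t => by
    rw [Complex.norm_real, Real.norm_eq_abs, abs_of_nonneg (h0 t)]
    exact hle t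
  refine ⟨(contDiff_quadOsc a κ).mul (Complex.ofRealCLM.contDiff.comp hχ), fun t ht => ?_,
    fun t => ?_, fun t => ?_⟩
  · simp [h1 t ht.le]
  · rw [norm_mul, norm_quadOsc, one_mul]
    linarith [hn t]
  · have hχd := (hχ.differentiable (by simp) t).hasDerivAt.ofReal_comp
    rw [((hasDerivAt_quadOsc a κ t).fun_mul hχd).deriv]
    have e1 : ‖quadOsc a κ t * ((deriv χ t : ℝ) : ℂ)‖ ≤ B := by
      rw [norm_mul, norm_quadOsc, one_mul, Complex.norm_real]
      exact hd t
    have e2 : ‖Complex.I * ((-(a + 2 * κ * t) : ℝ) : ℂ) * quadOsc a κ t * (χ t : ℂ)‖ ≤ K := by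
      rcases le_total 1 |t| with ht | ht
      · simpa [h1 t ht] using hK0
      · rw [norm_mul, norm_mul, norm_mul, norm_quadOsc, Complex.norm_I, Complex.norm_real,
          Real.norm_eq_abs, abs_neg, one_mul, mul_one]
        have : |a + 2 * κ * t| ≤ K := by
          calc |a + 2 * κ * t| ≤ |a| + |2 * κ * t| := abs_add_le _ _
            _ = |a| + 2 * |κ| * |t| := by rw [abs_mul, abs_mul, abs_two]
            _ ≤ |a| + 2 * |κ| * 1 := by gcongr
            _ ≤ K := by linarith
        calc _ ≤ K * 1 := mul_le_mul this (hn t) (norm_nonneg _) hK0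
          _ = K := mul_one K
    calc _ ≤ _ := norm_add_le _ _
      _ ≤ K + B := add_le_add e2 e1
      _ ≤ _ := by linarith

end Bump

section FlagKernel

variable {Cab : ℕ → ℕ → ℝ} {C1 : ℕ → ℝ} {C2 : ℝ} {M M' : ℝ → ℝ → ℂ}

lemma FlagF1FunBounds.norm_le (h : FlagF1FunBounds Cab C1 C2 M) {A : ℝ} (hA : 0 ≤ A)
    (hCA : Cab 0 0 ≤ A) (x : ℝ) {y : ℝ} (hy : y ≠ 0) : ‖M x y‖ ≤ A * (√|y| ^ 3)⁻¹ := by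
  have h0 := h.2.2.1 0 0 x y hy
  have hv : 0 < √|y| := Real.sqrt_pos.2 (abs_pos.2 hy)
  have hvv : |y| = √|y| ^ 2 := (Real.sq_sqrt (abs_nonneg y)).symm
  simp only [iteratedDeriv_zero, Nat.cast_zero, sub_zero, Real.rpow_neg_one,
    ← Real.sqrt_eq_rpow] at h0
  generalize √|y| = v at *
  rw [hvv] at h0
  calc ‖M x y‖ ≤ Cab 0 0 * (|x| + v)⁻¹ * (v ^ 2)⁻¹ := h0
    _ ≤ A * v⁻¹ * (v ^ 2)⁻¹ := by
        gcongr
        linarith [abs_nonneg x]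
    _ = A * (v ^ 3)⁻¹ := by field_simp

lemma FlagF1FunBounds.norm_hasDerivAt_le (h : FlagF1FunBounds Cab C1 C2 M)
    (hd : ∀ x y, HasDerivAt (fun x => M x y) (M' x y) x) {A : ℝ} (hA : 0 ≤ A)
    (hCA : Cab 1 0 ≤ A) (x : ℝ) {y : ℝ} (hy : y ≠ 0) :
    ‖M' x y‖ ≤ A * (√|y| ^ 3)⁻¹ * ((√|y|)⁻¹ / (1 + ((√|y|)⁻¹ * x) ^ 2)) := by
  have h0 := h.2.2.1 1 0 x y hy
  have hv : 0 < √|y| := Real.sqrt_pos.2 (abs_pos.2 hy)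
  have hvv : |y| = √|y| ^ 2 := (Real.sq_sqrt (abs_nonneg y)).symm
  simp only [iteratedDeriv_zero, iteratedDeriv_one, Nat.cast_zero, sub_zero, Real.rpow_neg_one,
    ← Real.sqrt_eq_rpow, Nat.cast_one, (hd x y).deriv] at h0
  rw [show (-1 - 1 : ℝ) = -2 by norm_num] at h0
  generalize √|y| = v at *
  rw [hvv, Real.rpow_neg (by positivity), Real.rpow_two] at h0
  calc ‖M' x y‖ ≤ Cab 1 0 * ((|x| + v) ^ 2)⁻¹ * (v ^ 2)⁻¹ := h0
    _ ≤ A * (v ^ 2 + x ^ 2)⁻¹ * (v ^ 2)⁻¹ := by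
        gcongr
        rw [← sq_abs x]
        nlinarith [mul_nonneg (abs_nonneg x) hv.le]
    _ = _ := by field_simp

/-- The part of the kernel away from the singular axis: oscillation in `x` alone gives
absolute integrability in `y`. -/
lemma FlagF1FunBounds.norm_integral_quadOsc_mul_le (h : FlagF1FunBounds Cab C1 C2 M) {A : ℝ}
    (hA : 0 ≤ A) (hA0 : Cab 0 0 ≤ A) (hA1 : Cab 1 0 ≤ A) {a κ : ℝ} (hκ : κ ≠ 0) {y : ℝ}
    (hy : y ≠ 0) :
    ‖∫ x, quadOsc a κ x * M x y‖ ≤ 2 * π * (A * (√|y| ^ 3)⁻¹) / √|κ| := by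
  obtain ⟨M', hc', -, hd⟩ := h.1.exists_hasDerivAt_fst h.2.1
  obtain ⟨B, hB⟩ := h.2.1.exists_forall_lt_abs_eq_zero
  have hv : 0 < √|y| := Real.sqrt_pos.2 (abs_pos.2 hy)
  exact norm_integral_quadOsc_mul_le_of_bounded hκ (fun x => hd x y)
    (hc'.comp (Continuous.prodMk_left y))
    (hasCompactSupport_of_forall_lt_abs fun x hx => hB x y (Or.inl hx)) (inv_pos.2 hv)
    (fun x => h.norm_le hA hA0 x hy) fun x => h.norm_hasDerivAt_le hd hA hA1 x hy

lemma IsNormalizedBump.continuous_ofReal_comp {φ : ℝ → ℝ} (h : IsNormalizedBump φ) (R : ℝ) :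
    Continuous fun t => (φ (R * t) : ℂ) := by
  have := h.1.continuous
  fun_prop

lemma IsComplexBump.continuous_comp {L : ℝ} {Θ : ℝ → ℂ} (h : IsComplexBump L Θ) (R : ℝ) :
    Continuous fun t => Θ (R * t) :=
  h.contDiff.continuous.comp (continuous_const_mul R)

variable {L : ℝ} {Θ : ℝ → ℂ}

lemma FlagF1FunBounds.integral_eq (h : FlagF1FunBounds Cab C1 C2 M) {φ₁ φ₂ : ℝ → ℝ}
    (h₁ : IsNormalizedBump φ₁) (h₂ : IsNormalizedBump φ₂)
    (hΘ : ∀ t, Θ t = L * ((φ₁ t : ℂ) + Complex.I * (φ₂ t : ℂ))) (R x : ℝ) :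
    ∫ y, M x y * Θ (R * y) = L * ((∫ y, M x y * (φ₁ (R * y) : ℂ))
      + Complex.I * ∫ y, M x y * (φ₂ (R * y) : ℂ)) := by
  have hc := h.1.continuous
  have i1 := integrable_section_mul hc h.2.1 (h₁.continuous_ofReal_comp R) x
  have i2 := integrable_section_mul hc h.2.1 (h₂.continuous_ofReal_comp R) x
  rw [← integral_const_mul, ← integral_add i1 (i2.const_mul _), ← integral_const_mul]
  congr 1 with y
  rw [hΘ]
  ring

lemma norm_ofReal_mul_add_I_mul_le (hL : 0 ≤ L) {z w : ℂ} {b : ℝ} (hz : ‖z‖ ≤ b) (hw : ‖w‖ ≤ b) :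
    ‖(L : ℂ) * (z + Complex.I * w)‖ ≤ 2 * L * b := by
  rw [norm_mul, Complex.norm_real, Real.norm_eq_abs, abs_of_nonneg hL]
  have : ‖z + Complex.I * w‖ ≤ b + b := (norm_add_le _ _).trans (by
    rw [norm_mul, Complex.norm_I, one_mul]
    gcongr)
  calc _ ≤ L * (b + b) := by gcongr
    _ = _ := by ring

lemma FlagF1FunBounds.norm_integral_bump_le (h : FlagF1FunBounds Cab C1 C2 M)
    (hΘ : IsComplexBump L Θ) (hL : 0 < L) {A R : ℝ} (hR : 0 < R) (hA : C1 0 ≤ A) {x : ℝ}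
    (hx : x ≠ 0) : ‖∫ y, M x y * Θ (R * y)‖ ≤ 2 * L * A / |x| := by
  obtain ⟨φ₁, φ₂, h₁, h₂, he⟩ := hΘ.exists_eq hL
  have key : ∀ φ, IsNormalizedBump φ → ‖∫ y, M x y * (φ (R * y) : ℂ)‖ ≤ A / |x| := fun φ hφ => by
    have := (h.2.2.2 φ hφ R hR).2.2.1 0 x hx
    simp only [iteratedDeriv_zero, Nat.cast_zero, sub_zero, Real.rpow_neg_one] at this
    rw [div_eq_mul_inv]
    exact this.trans (by gcongr)
  rw [h.integral_eq h₁ h₂ he, mul_div_assoc]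
  exact norm_ofReal_mul_add_I_mul_le hL.le (key φ₁ h₁) (key φ₂ h₂)

lemma FlagF1FunBounds.norm_deriv_integral_bump_le (h : FlagF1FunBounds Cab C1 C2 M)
    (hΘ : IsComplexBump L Θ) (hL : 0 < L) {A R : ℝ} (hR : 0 < R) (hA : C1 1 ≤ A) {x : ℝ}
    (hx : x ≠ 0) : ‖deriv (fun x => ∫ y, M x y * Θ (R * y)) x‖ ≤ 2 * L * A / x ^ 2 := by
  obtain ⟨φ₁, φ₂, h₁, h₂, he⟩ := hΘ.exists_eq hL
  obtain ⟨M', hc', hs', hd⟩ := h.1.exists_hasDerivAt_fst h.2.1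
  have hda : ∀ φ, IsNormalizedBump φ →
      DifferentiableAt ℝ (fun x => ∫ y, M x y * (φ (R * y) : ℂ)) x := fun φ hφ =>
    (hasDerivAt_integral_right h.1.continuous h.2.1 hc' hs' hd
      (hφ.continuous_ofReal_comp R) x).differentiableAt
  have key : ∀ φ, IsNormalizedBump φ →
      ‖deriv (fun x => ∫ y, M x y * (φ (R * y) : ℂ)) x‖ ≤ A / x ^ 2 := fun φ hφ => by
    have := (h.2.2.2 φ hφ R hR).2.2.1 1 x hx
    rw [iteratedDeriv_one, Nat.cast_one, show (-1 - 1 : ℝ) = -2 by norm_num,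
      Real.rpow_neg (abs_nonneg x), Real.rpow_two, sq_abs] at this
    rw [div_eq_mul_inv]
    exact this.trans (by gcongr)
  simp only [h.integral_eq h₁ h₂ he]
  rw [(((hda φ₁ h₁).hasDerivAt.fun_add ((hda φ₂ h₂).hasDerivAt.const_mul Complex.I)).const_mul
    (L : ℂ)).deriv, mul_div_assoc]
  exact norm_ofReal_mul_add_I_mul_le hL.le (key φ₁ h₁) (key φ₂ h₂)

lemma FlagF1FunBounds.norm_integral_integral_bump_le (h : FlagF1FunBounds Cab C1 C2 M)
    (hΘ : IsComplexBump L Θ) (hL : 0 < L) {L' : ℝ} {Θ' : ℝ → ℂ} (hΘ' : IsComplexBump L' Θ')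
    (hL' : 0 < L') {A R δ : ℝ} (hR : 0 < R) (hδ : 0 < δ) (hA : C2 ≤ A) :
    ‖∫ x, (∫ y, M x y * Θ (R * y)) * Θ' (δ * x)‖ ≤ 4 * L * L' * A := by
  obtain ⟨φ₁, φ₂, h₁, h₂, he⟩ := hΘ.exists_eq hL
  obtain ⟨ψ₁, ψ₂, g₁, g₂, ge⟩ := hΘ'.exists_eq hL'
  have hi : ∀ φ ψ, IsNormalizedBump φ → IsNormalizedBump ψ →
      Integrable fun x => (∫ y, M x y * (φ (R * y) : ℂ)) * (ψ (δ * x) : ℂ) := fun φ ψ hφ hψ =>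
    ((continuous_integral_right h.1.continuous h.2.1 (hφ.continuous_ofReal_comp R)).mul
      (hψ.continuous_ofReal_comp δ)).integrable_of_hasCompactSupport
      (hasCompactSupport_integral_right h.2.1).mul_right
  have key : ∀ φ ψ, IsNormalizedBump φ → IsNormalizedBump ψ →
      ‖∫ x, (∫ y, M x y * (φ (R * y) : ℂ)) * (ψ (δ * x) : ℂ)‖ ≤ A := fun φ ψ hφ hψ =>
    ((h.2.2.2 φ hφ R hR).2.2.2 δ hδ ψ hψ).trans hA
  have key' : ∀ φ, IsNormalizedBump φ →
      ‖∫ x, (∫ y, M x y * (φ (R * y) : ℂ)) * Θ' (δ * x)‖ ≤ 2 * L' * A := fun φ hφ => by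
    have : ∫ x, (∫ y, M x y * (φ (R * y) : ℂ)) * Θ' (δ * x)
        = L' * ((∫ x, (∫ y, M x y * (φ (R * y) : ℂ)) * (ψ₁ (δ * x) : ℂ))
          + Complex.I * ∫ x, (∫ y, M x y * (φ (R * y) : ℂ)) * (ψ₂ (δ * x) : ℂ)) := by
      rw [← integral_const_mul, ← integral_add (hi φ ψ₁ hφ g₁) ((hi φ ψ₂ hφ g₂).const_mul _),
        ← integral_const_mul]
      congr 1 with x
      rw [ge]
      ring
    rw [this]
    exact norm_ofReal_mul_add_I_mul_le hL'.le (key φ ψ₁ hφ g₁) (key φ ψ₂ hφ g₂)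
  have hi' : ∀ φ, IsNormalizedBump φ →
      Integrable fun x => (∫ y, M x y * (φ (R * y) : ℂ)) * Θ' (δ * x) := fun φ hφ =>
    ((continuous_integral_right h.1.continuous h.2.1 (hφ.continuous_ofReal_comp R)).mul
      (hΘ'.continuous_comp δ)).integrable_of_hasCompactSupport
      (hasCompactSupport_integral_right h.2.1).mul_right
  have : ∫ x, (∫ y, M x y * Θ (R * y)) * Θ' (δ * x)
      = L * ((∫ x, (∫ y, M x y * (φ₁ (R * y) : ℂ)) * Θ' (δ * x))
        + Complex.I * ∫ x, (∫ y, M x y * (φ₂ (R * y) : ℂ)) * Θ' (δ * x)) := by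
    rw [← integral_const_mul, ← integral_add (hi' φ₁ h₁) ((hi' φ₂ h₂).const_mul _),
      ← integral_const_mul]
    congr 1 with x
    rw [h.integral_eq h₁ h₂ he]
    ring
  rw [this]
  calc _ ≤ 2 * L * (2 * L' * A) :=
        norm_ofReal_mul_add_I_mul_le hL.le (key' φ₁ h₁) (key' φ₂ h₂)
    _ = _ := by ring

end FlagKernel

section Bound

variable {Cab : ℕ → ℕ → ℝ} {C1 : ℕ → ℝ} {C2 : ℝ} {M : ℝ → ℝ → ℂ}

/-- Oscillatory integral against the Calderón–Zygmund kernel obtained by integrating `M`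
against a bump in `y`. -/
lemma FlagF1FunBounds.norm_integral_quadOsc_mul_integral_bump_le
    (h : FlagF1FunBounds Cab C1 C2 M) {L : ℝ} {Θ : ℝ → ℂ} (hΘ : IsComplexBump L Θ) (hL : 0 < L)
    {χ : ℝ → ℝ} {B : ℝ} (hχ : ContDiff ℝ (⊤ : ℕ∞) χ) (hχi : ∀ t, |t| ≤ 1 / 2 → χ t = 1)
    (hχo : ∀ t, 1 ≤ |t| → χ t = 0) (hχ0 : ∀ t, 0 ≤ χ t) (hχ1 : ∀ t, χ t ≤ 1) (hB : 0 ≤ B)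
    (hχd : ∀ t, |deriv χ t| ≤ B) {A : ℝ} (hA : 0 ≤ A) (hA0 : C1 0 ≤ A) (hA1 : C1 1 ≤ A)
    (hA2 : C2 ≤ A) {R a κ : ℝ} (hR : 0 < R) (hκ : κ ≠ 0) :
    ‖∫ x, quadOsc a κ x * ∫ y, M x y * Θ (R * y)‖
      ≤ 4 * L * (4 + B) * A + 300 * π * (2 * L * A * (1 + B)) := by
  have hρ : 0 < |κ| := abs_pos.2 hκ
  have hsq : 0 < √|κ| := Real.sqrt_pos.2 hρ
  have hss : |κ| = √|κ| ^ 2 := (Real.sq_sqrt hρ.le).symm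
  set σ := |a| + √|κ| with hσdef
  have hσ : 0 < σ := by positivity
  set G : ℝ → ℂ := fun x => ∫ y, M x y * Θ (R * y) with hG
  obtain ⟨M', hc', hs', hd⟩ := h.1.exists_hasDerivAt_fst h.2.1
  have hc := h.1.continuous
  have hGd : ∀ x, HasDerivAt G (∫ y, M' x y * Θ (R * y)) x := fun x =>
    hasDerivAt_integral_right hc h.2.1 hc' hs' hd (hΘ.continuous_comp R) x
  have hGc : Continuous G := continuous_integral_right hc h.2.1 (hΘ.continuous_comp R)
  have hGc' : Continuous fun x => ∫ y, M' x y * Θ (R * y) :=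
    continuous_integral_right hc' hs' (hΘ.continuous_comp R)
  have hGs : HasCompactSupport G := hasCompactSupport_integral_right h.2.1
  have hχc : Continuous χ := hχ.continuous
  have hχc' : Continuous (deriv χ) := hχ.continuous_deriv (by simp)
  have hEc : Continuous (quadOsc a κ) := (contDiff_quadOsc a κ (n := 0)).continuous
  have hGle : ∀ x, x ≠ 0 → ‖G x‖ ≤ 2 * L * A / |x| := fun x hx =>
    h.norm_integral_bump_le hΘ hL hR hA0 hx
  have hGle' : ∀ x, x ≠ 0 → ‖∫ y, M' x y * Θ (R * y)‖ ≤ 2 * L * A / x ^ 2 := fun x hx => by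
    rw [← (hGd x).deriv]
    exact h.norm_deriv_integral_bump_le hΘ hL hR hA1 hx
  have near : ‖∫ x, G x * (quadOsc (a / σ) (κ / σ ^ 2) (σ * x) * χ (σ * x))‖
      ≤ 4 * L * (1 + B + 3) * A := by
    refine h.norm_integral_integral_bump_le hΘ hL
      (isComplexBump_quadOsc_mul hχ hχo hχ0 hχ1 hB hχd ?_) (by positivity) hR hσ hA2
    rw [abs_div, abs_div, abs_of_pos hσ, abs_of_pos (pow_pos hσ 2)]
    have h1 : |a| / σ ≤ 1 := (div_le_one hσ).2 (by simp [hσdef])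
    have h2 : |κ| / σ ^ 2 ≤ 1 := by
      rw [div_le_one (by positivity), hss]
      gcongr
      simp [hσdef]
    linarith
  set g : ℝ → ℂ := fun x => ((1 - χ (σ * x) : ℝ) : ℂ) * G x with hg
  set g' : ℝ → ℂ := fun x => ((-(deriv χ (σ * x) * σ) : ℝ) : ℂ) * G x
    + ((1 - χ (σ * x) : ℝ) : ℂ) * ∫ y, M' x y * Θ (R * y) with hg'
  have hgd : ∀ x, HasDerivAt g (g' x) x := fun x => by
    have h1 : HasDerivAt (fun x => χ (σ * x)) (deriv χ (σ * x) * σ) x :=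
      ((hχ.differentiable (by simp) (σ * x)).hasDerivAt).comp x
        (((hasDerivAt_id' x).const_mul σ).congr_deriv (mul_one σ))
    exact (h1.const_sub 1).ofReal_comp.mul (hGd x)
  have n1 : ∀ t, ‖((1 - χ t : ℝ) : ℂ)‖ ≤ 1 := fun t => by
    rw [Complex.norm_real, Real.norm_eq_abs, abs_of_nonneg (by linarith [hχ1 t])]
    linarith [hχ0 t]
  have far : ‖∫ x, quadOsc a κ x * g x‖ ≤ 300 * π * (2 * L * A * (1 + B)) := by
    refine norm_integral_quadOsc_mul_le_of_truncated hκ hgd (by fun_prop) hGs.mul_left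
      (by positivity) (fun x hx => ?_) (fun x hx => ?_) (fun x hx => ?_)
    · have hx' : |σ * x| ≤ 1 / 2 := by
        rw [abs_mul, abs_of_pos hσ]
        exact hx.le
      have e1 := hχi _ hx'
      have e2 : deriv χ (σ * x) = 0 := deriv_eq_zero_of_isMaxOn fun s => by
        rw [e1]
        exact hχ1 s
      simp [hg, hg', e1, e2]
    · calc ‖g x‖ ≤ 1 * (2 * L * A / |x|) := by
            rw [norm_mul]
            exact mul_le_mul (n1 _) (hGle x hx) (norm_nonneg _) zero_le_one
        _ ≤ 2 * L * A * (1 + B) / |x| := by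
            rw [one_mul]
            exact div_le_div_of_nonneg_right
              (le_mul_of_one_le_right (by positivity) (by linarith)) (abs_nonneg x)
    · have hx0 : 0 < |x| := abs_pos.2 hx
      have e1 : |deriv χ (σ * x)| * σ ≤ B / |x| := by
        rcases le_total 1 (σ * |x|) with hx1 | hx1
        · have : deriv χ (σ * x) = 0 := by
            have h1 : 1 ≤ |σ * x| := by rwa [abs_mul, abs_of_pos hσ]
            exact deriv_eq_zero_of_isMinOn fun s => by
              rw [hχo _ h1]
              exact hχ0 s
          rw [this, abs_zero, zero_mul]
          positivity
        · rw [le_div_iff₀ hx0, mul_assoc]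
          calc _ ≤ B * 1 := mul_le_mul (hχd _) hx1 (by positivity) hB
            _ = B := mul_one B
      calc ‖g' x‖ ≤ (|deriv χ (σ * x)| * σ) * ‖G x‖
            + ‖((1 - χ (σ * x) : ℝ) : ℂ)‖ * ‖∫ y, M' x y * Θ (R * y)‖ := by
            refine (norm_add_le _ _).trans (le_of_eq ?_)
            rw [norm_mul, norm_mul, Complex.norm_real, Real.norm_eq_abs, abs_neg, abs_mul,
              abs_of_pos hσ]
        _ ≤ B / |x| * (2 * L * A / |x|) + 1 * (2 * L * A / x ^ 2) := by
            gcongr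
            · exact hGle x hx
            · exact n1 _
            · exact hGle' x hx
        _ = 2 * L * A * (1 + B) / x ^ 2 := by
            rw [← sq_abs x]
            field_simp
            ring
  have split : ∫ x, quadOsc a κ x * G x
      = (∫ x, G x * (quadOsc (a / σ) (κ / σ ^ 2) (σ * x) * χ (σ * x)))
        + ∫ x, quadOsc a κ x * g x := by
    have hEc' : Continuous (quadOsc (a / σ) (κ / σ ^ 2)) :=
      (contDiff_quadOsc _ _ (n := 0)).continuous
    have i1 : Integrable fun x => G x * (quadOsc (a / σ) (κ / σ ^ 2) (σ * x) * χ (σ * x)) :=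
      Continuous.integrable_of_hasCompactSupport (by fun_prop) hGs.mul_right
    have i2 : Integrable fun x => quadOsc a κ x * g x :=
      Continuous.integrable_of_hasCompactSupport (by fun_prop) hGs.mul_left.mul_left
    rw [← integral_add i1 i2]
    congr 1 with x
    have : quadOsc (a / σ) (κ / σ ^ 2) (σ * x) = quadOsc a κ x := by
      simp only [quadOsc]
      congr 1
      field_simp
    rw [this]
    simp only [hg]
    push_cast
    ring
  rw [split]
  calc _ ≤ _ := norm_add_le _ _
    _ ≤ 4 * L * (1 + B + 3) * A + 300 * π * (2 * L * A * (1 + B)) := add_le_add near far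
    _ = _ := by ring

lemma integrable_one_add_abs_rpow : Integrable fun t : ℝ => (1 + |t|) ^ (-(3 / 2) : ℝ) := by
  have := integrable_one_add_norm (E := ℝ) (μ := volume) (r := 3 / 2) (by norm_num)
  simpa only [Real.norm_eq_abs] using this

lemma inv_sqrt_pow_three_le {b y : ℝ} (hb : b ≠ 0) (h : 1 / 2 ≤ |b * y|) :
    (√|y| ^ 3)⁻¹ ≤ 6 * √|b| ^ 3 * (1 + |b * y|) ^ (-(3 / 2) : ℝ) := by
  have hb0 : 0 < |b| := abs_pos.2 hb
  have hy0 : 0 < |y| := by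
    rw [abs_mul] at h
    by_contra hn
    have : |y| = 0 := le_antisymm (not_lt.1 hn) (abs_nonneg y)
    rw [this] at h
    norm_num at h
  have hp : 0 < 1 + |b * y| := by positivity
  have e : (1 + |b * y|) ^ (-(3 / 2) : ℝ) = (√(1 + |b * y|) ^ 3)⁻¹ := by
    rw [Real.rpow_neg hp.le, Real.sqrt_eq_rpow, ← Real.rpow_natCast, ← Real.rpow_mul hp.le]
    norm_num
  have hsb : 0 < √|b| := Real.sqrt_pos.2 hb0
  have hsy : 0 < √|y| := Real.sqrt_pos.2 hy0
  have hsp : 0 < √(1 + |b * y|) := Real.sqrt_pos.2 hp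
  rw [e, ← div_eq_mul_inv, inv_eq_one_div, div_le_div_iff₀ (by positivity) (by positivity), one_mul]
  have h3 : √(1 + |b * y|) ≤ √3 * (√|b| * √|y|) := by
    rw [← Real.sqrt_mul (abs_nonneg b), ← abs_mul, ← Real.sqrt_mul (by norm_num)]
    exact Real.sqrt_le_sqrt (by linarith)
  have h4 : √3 ^ 3 ≤ 6 := by
    have : √(3 : ℝ) ≤ 2 := Real.sqrt_le_iff.2 ⟨by norm_num, by norm_num⟩
    calc √(3 : ℝ) ^ 3 = √3 ^ 2 * √3 := by ring
      _ = 3 * √3 := by rw [Real.sq_sqrt (by norm_num)]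
      _ ≤ 6 := by linarith
  calc √(1 + |b * y|) ^ 3 ≤ (√3 * (√|b| * √|y|)) ^ 3 := by gcongr
    _ = √3 ^ 3 * (√|b| * √|y|) ^ 3 := by ring
    _ ≤ 6 * (√|b| * √|y|) ^ 3 := by gcongr
    _ = _ := by ring

/-- The contribution of the region away from the singular axis. -/
lemma FlagF1FunBounds.norm_integral_far_le (h : FlagF1FunBounds Cab C1 C2 M) {A : ℝ}
    (hA : 0 ≤ A) (hA0 : Cab 0 0 ≤ A) (hA1 : Cab 1 0 ≤ A) {c a b : ℝ} (hc : 0 < c) (hb : b ≠ 0)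
    {W : ℝ → ℂ} (hW1 : ∀ y, ‖W y‖ ≤ 1) (hW0 : ∀ y, |b * y| ≤ 1 / 2 → W y = 0) :
    ‖∫ y, W y * ∫ x, quadOsc a (c * b) x * M x y‖
      ≤ 12 * π * A / √c * ∫ t : ℝ, (1 + |t|) ^ (-(3 / 2) : ℝ) := by
  have hb0 : 0 < |b| := abs_pos.2 hb
  have hsb : 0 < √|b| := Real.sqrt_pos.2 hb0
  have hsc : 0 < √c := Real.sqrt_pos.2 hc
  have hκ : c * b ≠ 0 := mul_ne_zero hc.ne' hb
  have hi : Integrable fun y : ℝ => 12 * π * A / √c * |b| * (1 + |b * y|) ^ (-(3 / 2) : ℝ) :=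
    (integrable_one_add_abs_rpow.comp_mul_left' hb).const_mul _
  refine (norm_integral_le_of_norm_le hi (Eventually.of_forall fun y => ?_)).trans ?_
  · rw [norm_mul]
    rcases le_total |b * y| (1 / 2) with hy | hy
    · rw [hW0 y hy, norm_zero, zero_mul]
      positivity
    · have hy0 : y ≠ 0 := by
        rintro rfl
        norm_num at hy
      have hκs : √|c * b| = √c * √|b| := by
        rw [abs_mul, abs_of_pos hc, Real.sqrt_mul hc.le]
      calc _ ≤ 1 * (2 * π * (A * (√|y| ^ 3)⁻¹) / √|c * b|) :=
            mul_le_mul (hW1 y) (h.norm_integral_quadOsc_mul_le hA hA0 hA1 hκ hy0)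
              (norm_nonneg _) zero_le_one
        _ ≤ 1 * (2 * π * (A * (6 * √|b| ^ 3 * (1 + |b * y|) ^ (-(3 / 2) : ℝ))) / √|c * b|) := by
            gcongr
            exact inv_sqrt_pow_three_le hb hy
        _ = 12 * π * A / √c * √|b| ^ 2 * (1 + |b * y|) ^ (-(3 / 2) : ℝ) := by
            rw [hκs]
            field_simp
            ring
        _ = _ := by rw [Real.sq_sqrt hb0.le]
  · rw [integral_const_mul, Measure.integral_comp_mul_left (fun t : ℝ => (1 + |t|) ^ (-(3 / 2) : ℝ)),
      smul_eq_mul, abs_inv]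
    apply le_of_eq
    field_simp

theorem exists_norm_integral_integral_quadOsc_le {c : ℝ} (hc : 0 < c) (Cab : ℕ → ℕ → ℝ)
    (C1 : ℕ → ℝ) (C2 : ℝ) :
    ∃ C : ℝ, ∀ M : ℝ → ℝ → ℂ, FlagF1FunBounds Cab C1 C2 M → ∀ a b : ℝ, b ≠ 0 →
      ‖∫ x, ∫ y, quadOsc a (c * b) x * quadOsc b 0 y * M x y‖ ≤ C := by
  obtain ⟨χ, B, hχ, hB, hχi, hχo, hχ0, hχ1, hχd⟩ := exists_smooth_cutoff
  obtain ⟨A, hA, hA0, hA1, hA2, hA3, hA4⟩ : ∃ A : ℝ, 0 ≤ A ∧ Cab 0 0 ≤ A ∧ Cab 1 0 ≤ A ∧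
      C1 0 ≤ A ∧ C1 1 ≤ A ∧ C2 ≤ A :=
    ⟨max 0 (max (Cab 0 0) (max (Cab 1 0) (max (C1 0) (max (C1 1) C2)))), by simp⟩
  refine ⟨4 * (1 + B + 1) * (4 + B) * A + 300 * π * (2 * (1 + B + 1) * A * (1 + B))
    + 12 * π * A / √c * ∫ t : ℝ, (1 + |t|) ^ (-(3 / 2) : ℝ), fun M h a b hb => ?_⟩
  have hb0 : 0 < |b| := abs_pos.2 hb
  set Θ : ℝ → ℂ := fun t => quadOsc (b / |b|) 0 t * χ t with hΘdef
  have hΘ : IsComplexBump (1 + B + 1) Θ :=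
    isComplexBump_quadOsc_mul hχ hχo hχ0 hχ1 hB hχd (by simp [abs_div, hb])
  set W : ℝ → ℂ := fun y => quadOsc b 0 y * (1 - χ (|b| * y) : ℝ) with hW
  have hEc : ∀ a κ : ℝ, Continuous (quadOsc a κ) := fun a κ =>
    (contDiff_quadOsc a κ (n := 0)).continuous
  have hEb := hEc b 0
  have hEa := hEc a (c * b)
  have hχc : Continuous χ := hχ.continuous
  have hWc : Continuous W := by fun_prop
  have hMc : Continuous fun p : ℝ × ℝ => M p.1 p.2 := h.1.continuous
  have hsum : ∀ y, Θ (|b| * y) + W y = quadOsc b 0 y := fun y => by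
    have : quadOsc (b / |b|) 0 (|b| * y) = quadOsc b 0 y := by
      simp only [quadOsc]
      congr 1
      field_simp
      ring
    simp only [hΘdef, hW, this]
    push_cast
    ring
  have inner : ∀ x, ∫ y, quadOsc a (c * b) x * quadOsc b 0 y * M x y
      = quadOsc a (c * b) x * (∫ y, M x y * Θ (|b| * y))
        + quadOsc a (c * b) x * ∫ y, M x y * W y := fun x => by
    rw [← mul_add, ← integral_add (integrable_section_mul hMc h.2.1 (hΘ.continuous_comp _) x)
      (integrable_section_mul hMc h.2.1 hWc x), ← integral_const_mul]
    congr 1 with y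
    rw [← hsum y]
    ring
  have i1 : Integrable fun x => quadOsc a (c * b) x * ∫ y, M x y * Θ (|b| * y) :=
    Continuous.integrable_of_hasCompactSupport
      (hEa.mul (continuous_integral_right hMc h.2.1 (hΘ.continuous_comp _)))
      (hasCompactSupport_integral_right h.2.1).mul_left
  have i2 : Integrable fun x => quadOsc a (c * b) x * ∫ y, M x y * W y :=
    Continuous.integrable_of_hasCompactSupport
      (hEa.mul (continuous_integral_right hMc h.2.1 hWc))
      (hasCompactSupport_integral_right h.2.1).mul_left
  have swap : ∫ x, quadOsc a (c * b) x * ∫ y, M x y * W y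
      = ∫ y, W y * ∫ x, quadOsc a (c * b) x * M x y := by
    simp only [← integral_const_mul]
    rw [integral_integral_swap_of_hasCompactSupport
      (f := fun x y => quadOsc a (c * b) x * (M x y * W y))]
    · congr 1 with y
      congr 1 with x
      ring
    · exact (hEa.comp continuous_fst).mul (hMc.mul (hWc.comp continuous_snd))
    · exact (HasCompactSupport.mul_right h.2.1).mul_left
  simp only [inner]
  rw [integral_add i1 i2, swap]
  refine (norm_add_le _ _).trans (add_le_add ?_ ?_)
  · exact h.norm_integral_quadOsc_mul_integral_bump_le hΘ (by positivity) hχ hχi hχo hχ0 hχ1 hB hχd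
      hA hA2 hA3 hA4 hb0 (mul_ne_zero hc.ne' hb)
  · refine h.norm_integral_far_le hA hA0 hA1 hc hb (fun y => ?_) fun y hy => ?_
    · rw [norm_mul, norm_quadOsc, one_mul, Complex.norm_real, Real.norm_eq_abs,
        abs_of_nonneg (by linarith [hχ1 (|b| * y)])]
      linarith [hχ0 (|b| * y)]
    · have : χ (|b| * y) = 1 := hχi _ (by rwa [abs_mul, abs_abs, ← abs_mul])
      simp [hW, this]

end Bound

section Fourier

variable {M : ℝ → ℝ → ℂ}

lemma hasCompactSupport_shear (hs : HasCompactSupport fun p : ℝ × ℝ => M p.1 p.2) (c : ℝ) :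
    HasCompactSupport fun p : ℝ × ℝ => M p.1 (p.2 - c * p.1 ^ 2) := by
  let e : (ℝ × ℝ) ≃ₜ (ℝ × ℝ) :=
    { toFun := fun p => (p.1, p.2 - c * p.1 ^ 2)
      invFun := fun p => (p.1, p.2 + c * p.1 ^ 2)
      left_inv := fun p => by simp
      right_inv := fun p => by simp
      continuous_toFun := by fun_prop
      continuous_invFun := by fun_prop }
  exact hs.comp_homeomorph e

lemma integral_eI_mul_shear_eq (hM : Continuous fun p : ℝ × ℝ => M p.1 p.2)
    (hs : HasCompactSupport fun p : ℝ × ℝ => M p.1 p.2) (c ξ η : ℝ) :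
    ∫ p : ℝ × ℝ, eI (-2 * π * (p.1 * ξ + p.2 * η)) * M p.1 (p.2 - c * p.1 ^ 2)
      = ∫ x, ∫ y, quadOsc (2 * π * ξ) (c * (2 * π * η)) x * quadOsc (2 * π * η) 0 y * M x y := by
  have hc : Continuous fun p : ℝ × ℝ =>
      eI (-2 * π * (p.1 * ξ + p.2 * η)) * M p.1 (p.2 - c * p.1 ^ 2) :=
    (continuous_eI.comp (by fun_prop)).mul
      (hM.comp (f := fun p : ℝ × ℝ => (p.1, p.2 - c * p.1 ^ 2)) (by fun_prop))
  have hi := hc.integrable_of_hasCompactSupport (μ := volume)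
    (hasCompactSupport_shear hs c).mul_left
  rw [Measure.volume_eq_prod] at hi ⊢
  rw [integral_prod _ hi]
  congr 1 with x
  rw [← integral_add_right_eq_self _ (c * x ^ 2)]
  congr 1 with y
  simp only [add_sub_cancel_right, quadOsc, ← eI_add]
  congr 2
  ring

lemma continuous_integral_eI_mul_shear (hM : Continuous fun p : ℝ × ℝ => M p.1 p.2)
    (hs : HasCompactSupport fun p : ℝ × ℝ => M p.1 p.2) (c ξ : ℝ) :
    Continuous fun η : ℝ =>
      ∫ p : ℝ × ℝ, eI (-2 * π * (p.1 * ξ + p.2 * η)) * M p.1 (p.2 - c * p.1 ^ 2) := by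
  have hK : Continuous fun p : ℝ × ℝ => M p.1 (p.2 - c * p.1 ^ 2) :=
    hM.comp (f := fun p : ℝ × ℝ => (p.1, p.2 - c * p.1 ^ 2)) (by fun_prop)
  have hi := hK.integrable_of_hasCompactSupport (μ := volume) (hasCompactSupport_shear hs c)
  refine continuous_of_dominated (fun η => ?_) (fun η => ?_) hi.norm ?_
  · exact ((continuous_eI.comp (by fun_prop)).mul hK).aestronglyMeasurable
  · exact Eventually.of_forall fun p => by rw [norm_mul, norm_eI, one_mul]
  · exact Eventually.of_forall fun p => (continuous_eI.comp (by fun_prop)).mul continuous_const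

end Fourier

/-- The Fourier transform of the curved flag kernel
`K(x,y) = M(x, y - c₀x²)` is bounded, uniformly over all `M` satisfying the flag-`F₁`
seminorm bounds with fixed constants (in particular, independently of the support of `M`). -/
theorem curved_kernel_fourier_transform_bounded (c₀ : ℝ) (hc₀ : 0 < c₀)
    (Cab : ℕ → ℕ → ℝ) (C1 : ℕ → ℝ) (C2 : ℝ) :
    ∃ C : ℝ, ∀ M : ℝ → ℝ → ℂ, FlagF1FunBounds Cab C1 C2 M →
      ∀ ξ η : ℝ,
        ‖∫ p : ℝ × ℝ, eI (-2 * π * (p.1 * ξ + p.2 * η)) * M p.1 (p.2 - c₀ * p.1 ^ 2)‖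
          ≤ C := by
  obtain ⟨C, hC⟩ := exists_norm_integral_integral_quadOsc_le hc₀ Cab C1 C2
  refine ⟨C, fun M h ξ => ?_⟩
  have hM : Continuous fun p : ℝ × ℝ => M p.1 p.2 := h.1.continuous
  have hclosed := isClosed_le (continuous_integral_eI_mul_shear hM h.2.1 c₀ ξ).norm
    (continuous_const (y := C))
  have hdense : Dense ({0}ᶜ : Set ℝ) := dense_compl_singleton 0
  refine fun η => hclosed.closure_subset_iff.2 (fun η hη => ?_) (hdense η)
  change ‖_‖ ≤ C
  rw [integral_eI_mul_shear_eq hM h.2.1]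
  exact hC M h _ _ (mul_ne_zero (by positivity) hη)
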